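/- arXiv:2307.05900 — 10 statements merged into one kernel-verified Lean document; each statement's English description precedes it below -/
import Mathlib

section
/- Let M be an n×n real symmetric positive definite matrix and let Π be an n×n real matrix with Π² = Π, Π ≠ 0, and Π ≠ I. Then the M-operator norms of Π and I−Π are equal: ‖Π‖_M = ‖I−Π‖_M. -/
open Matrix

/-- The `M`-norm of a vector: `‖x‖_M = ⟨Mx, x⟩^{1/2}`. -/
noncomputable def mnorm {n : ℕ} (M : Matrix (Fin n) (Fin n) ℝ) (x : Fin n → ℝ) : ℝ :=
  Real.sqrt (M.mulVec x ⬝ᵥ x)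

/-- The `M`-operator norm of a matrix: `‖T‖_M = sup_{x ≠ 0} ‖Tx‖_M / ‖x‖_M`. -/
noncomputable def mopnorm {n : ℕ} (M T : Matrix (Fin n) (Fin n) ℝ) : ℝ :=
  ⨆ x : {x : Fin n → ℝ // x ≠ 0}, mnorm M (T.mulVec x.1) / mnorm M x.1

theorem mform_symm {n : ℕ} {M : Matrix (Fin n) (Fin n) ℝ} (hM : M.PosDef) (u v : Fin n → ℝ) :
    M.mulVec u ⬝ᵥ v = M.mulVec v ⬝ᵥ u := by
  have h : Mᵀ = M := by simpa [Matrix.IsHermitian, Matrix.conjTranspose_eq_transpose_of_trivial] using hM.1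
  rw [dotProduct_comm, Matrix.dotProduct_mulVec, ← Matrix.mulVec_transpose, h]

theorem mform_pos {n : ℕ} {M : Matrix (Fin n) (Fin n) ℝ} (hM : M.PosDef) {u : Fin n → ℝ}
    (hu : u ≠ 0) : 0 < M.mulVec u ⬝ᵥ u := by
  have := hM.dotProduct_mulVec_pos hu
  rw [dotProduct_comm]
  simpa using this

theorem mratio_dom {n : ℕ} (M P : Matrix (Fin n) (Fin n) ℝ)
    (hM : M.PosDef) (hproj : P * P = P) (hP1 : P ≠ 1) (x : {x : Fin n → ℝ // x ≠ 0}) :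
    ∃ y : {x : Fin n → ℝ // x ≠ 0},
      mnorm M (P.mulVec x.1) / mnorm M x.1 ≤ mnorm M ((1 - P).mulVec y.1) / mnorm M y.1 := by
  obtain ⟨x, hx⟩ := x
  obtain ⟨u, hu⟩ : ∃ u, u = P.mulVec x := ⟨_, rfl⟩
  obtain ⟨v, hv⟩ : ∃ v, v = x - P.mulVec x := ⟨_, rfl⟩
  have hPu : P.mulVec u = u := by rw [hu, Matrix.mulVec_mulVec, hproj]
  have hPv : P.mulVec v = 0 := by
    rw [hv, Matrix.mulVec_sub, Matrix.mulVec_mulVec, hproj, sub_self]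
  have hxuv : x = u + v := by rw [hu, hv]; abel
  by_cases hu0 : u = 0
  · refine ⟨⟨x, hx⟩, ?_⟩
    simp only [← hu, hu0]
    have : mnorm M 0 = 0 := by simp [mnorm]
    rw [this, zero_div]
    unfold mnorm
    positivity
  by_cases hv0 : v = 0
  · have h1 : (1 - P) ≠ 0 := fun h => hP1 (sub_eq_zero.mp h).symm
    obtain ⟨z, hz⟩ : ∃ z, (1 - P).mulVec z ≠ 0 := by
      by_contra! h
      apply h1
      apply Matrix.toLin'.injective
      refine LinearMap.ext fun z => ?_
      rw [Matrix.toLin'_apply, h z]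
      simp
    refine ⟨⟨_, hz⟩, ?_⟩
    have h2 : (1 - P).mulVec ((1 - P).mulVec z) = (1 - P).mulVec z := by
      rw [Matrix.mulVec_mulVec]
      congr 1
      simp [sub_mul, mul_sub, hproj]
    have hxu : x = u := by rw [hxuv, hv0, add_zero]
    simp only [h2]
    rw [hxu, hPu, div_self, div_self]
    · exact (Real.sqrt_pos.2 (mform_pos hM hz)).ne'
    · exact (Real.sqrt_pos.2 (mform_pos hM hu0)).ne'
  have pu := mform_pos hM hu0
  have pv := mform_pos hM hv0
  obtain ⟨s, hs⟩ : ∃ s, s = Real.sqrt (M.mulVec u ⬝ᵥ u) := ⟨_, rfl⟩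
  obtain ⟨t, ht⟩ : ∃ t, t = Real.sqrt (M.mulVec v ⬝ᵥ v) := ⟨_, rfl⟩
  have hs0 : 0 < s := hs ▸ Real.sqrt_pos.2 pu
  have ht0 : 0 < t := ht ▸ Real.sqrt_pos.2 pv
  have hs2 : M.mulVec u ⬝ᵥ u = s ^ 2 := by rw [hs, Real.sq_sqrt pu.le]
  have ht2 : M.mulVec v ⬝ᵥ v = t ^ 2 := by rw [ht, Real.sq_sqrt pv.le]
  have hy : (t / s) • u + (s / t) • v ≠ 0 := by
    intro h
    have := congrArg P.mulVec h
    rw [Matrix.mulVec_add, Matrix.mulVec_smul, Matrix.mulVec_smul, hPu, hPv, smul_zero, add_zero,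
      Matrix.mulVec_zero, smul_eq_zero] at this
    rcases this with h | h
    · exact (div_pos ht0 hs0).ne' h
    · exact hu0 h
  refine ⟨⟨_, hy⟩, le_of_eq ?_⟩
  have e1 : (1 - P).mulVec ((t / s) • u + (s / t) • v) = (s / t) • v := by
    rw [Matrix.sub_mulVec, Matrix.one_mulVec, Matrix.mulVec_add, Matrix.mulVec_smul,
      Matrix.mulVec_smul, hPu, hPv]
    simp
  have e2 : mnorm M ((s / t) • v) = mnorm M u := by
    unfold mnorm
    congr 1
    simp only [Matrix.mulVec_smul, smul_dotProduct, dotProduct_smul, smul_eq_mul, hs2, ht2]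
    field_simp
  have e3 : mnorm M ((t / s) • u + (s / t) • v) = mnorm M x := by
    unfold mnorm
    congr 1
    rw [hxuv]
    simp only [Matrix.mulVec_add, Matrix.mulVec_smul, add_dotProduct, dotProduct_add,
      smul_dotProduct, dotProduct_smul, smul_eq_mul, hs2, ht2, mform_symm hM v u]
    field_simp
    ring
  simp only [e1, e2, e3, ← hu]

theorem real_iSup_le_of_dom {ι : Type*} [Nonempty ι] (f g : ι → ℝ) (h1 : ∀ i, ∃ j, f i ≤ g j)
    (hg : BddAbove (Set.range g)) : iSup f ≤ iSup g :=
  ciSup_le fun i => (h1 i).elim fun j hj => hj.trans (le_ciSup hg j)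

theorem bdd_of_dom {ι : Type*} (f g : ι → ℝ) (h1 : ∀ i, ∃ j, f i ≤ g j)
    (hg : BddAbove (Set.range g)) : BddAbove (Set.range f) := by
  obtain ⟨C, hC⟩ := hg
  refine ⟨C, ?_⟩
  rintro _ ⟨i, rfl⟩
  obtain ⟨j, hj⟩ := h1 i
  exact hj.trans (hC ⟨j, rfl⟩)

theorem real_iSup_eq_of_dom {ι : Type*} (f g : ι → ℝ) (h1 : ∀ i, ∃ j, f i ≤ g j)
    (h2 : ∀ i, ∃ j, g i ≤ f j) : iSup f = iSup g := by
  rcases isEmpty_or_nonempty ι with h | h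
  · simp
  by_cases hg : BddAbove (Set.range g)
  · exact le_antisymm (real_iSup_le_of_dom f g h1 hg)
      (real_iSup_le_of_dom g f h2 (bdd_of_dom f g h1 hg))
  · rw [Real.iSup_of_not_bddAbove hg,
      Real.iSup_of_not_bddAbove fun hf => hg (bdd_of_dom g f h2 hf)]

/-- For SPD `M` and a projection `Pr` with `Pr ≠ 0` and `Pr ≠ I`,
`‖Pr‖_M = ‖I - Pr‖_M`. -/
theorem norm_proj_eq_norm_complement {n : ℕ} (M Pr : Matrix (Fin n) (Fin n) ℝ)
    (hM : M.PosDef) (hproj : Pr * Pr = Pr) (hPr0 : Pr ≠ 0) (hPr1 : Pr ≠ 1) :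
    mopnorm M Pr = mopnorm M (1 - Pr) := by
  unfold mopnorm
  apply real_iSup_eq_of_dom
  · exact mratio_dom M Pr hM hproj hPr1
  · have := mratio_dom M (1 - Pr) hM (by simp [sub_mul, mul_sub, hproj])
      (fun h => hPr0 (by simpa using h))
    simpa only [sub_sub_cancel] using this
end

section
/- Let M be an n×n real symmetric positive definite matrix and Π an n×n real matrix with Π² = Π and rank(Π) = n_c. Let V and U be n×n_c real matrices of full column rank with Range(V) = Range(Π) and Range(U) = Range(Π†), where Π† = M⁻¹Π*M. Then the n_c×n_c matrix U*MV is invertible and Π = V(U*MV)⁻¹U*M. -/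
open Matrix

theorem factor_of_range_le {a b c : ℕ} (A : Matrix (Fin a) (Fin b) ℝ)
    (B : Matrix (Fin a) (Fin c) ℝ)
    (h : LinearMap.range A.mulVecLin ≤ LinearMap.range B.mulVecLin) :
    ∃ C : Matrix (Fin c) (Fin b) ℝ, A = B * C := by
  have h1 : ∀ j : Fin b, ∃ v : Fin c → ℝ, B *ᵥ v = A *ᵥ (Pi.single j 1) := by
    intro j
    obtain ⟨v, hv⟩ := h ⟨Pi.single j 1, rfl⟩
    exact ⟨v, by simpa using hv⟩
  choose f hf using h1
  refine ⟨Matrix.of fun i j => f j i, ?_⟩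
  ext i j
  have := congrFun (hf j) i
  rw [Matrix.mulVec_single_one] at this
  simp only [Matrix.col_apply] at this
  rw [← this]
  rfl

/-- Let `M` be SPD, `Pr` a projection of rank `n_c`, and `V`, `U` be
`n × n_c` matrices of full column rank with `Range(V) = Range(Pr)` and
`Range(U) = Range(Pr†)` where `Pr† = M⁻¹ Prᵀ M`. Then `Uᵀ M V` is invertible and
`Pr = V (Uᵀ M V)⁻¹ Uᵀ M`. -/
theorem projection_representation {n nc : ℕ} (M Pr : Matrix (Fin n) (Fin n) ℝ)
    (V U : Matrix (Fin n) (Fin nc) ℝ)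
    (hM : M.PosDef) (hproj : Pr * Pr = Pr) (hrank : Pr.rank = nc)
    (hV : LinearMap.ker V.mulVecLin = ⊥) (hU : LinearMap.ker U.mulVecLin = ⊥)
    (hRV : LinearMap.range V.mulVecLin = LinearMap.range Pr.mulVecLin)
    (hRU : LinearMap.range U.mulVecLin = LinearMap.range (M⁻¹ * Prᵀ * M).mulVecLin) :
    IsUnit (Uᵀ * M * V) ∧ Pr = V * (Uᵀ * M * V)⁻¹ * (Uᵀ * M) := by
  have hMu : IsUnit M.det := hM.isUnit.map Matrix.detMonoidHom
  have hMT : Mᵀ = M := by simpa using hM.isHermitian.eq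
  obtain ⟨E, hE⟩ := factor_of_range_le Pr V hRV.ge
  obtain ⟨F, hF⟩ := factor_of_range_le V Pr hRV.le
  obtain ⟨C, hC⟩ := factor_of_range_le U _ hRU.le
  obtain ⟨D, hD⟩ := factor_of_range_le _ U hRU.ge
  have hPV : Pr * V = V := by
    rw [hF, ← Matrix.mul_assoc, hproj]
  have hUM : Uᵀ * M = Cᵀ * M * Pr := by
    rw [hC]
    simp only [Matrix.transpose_mul, Matrix.transpose_nonsing_inv, Matrix.transpose_transpose, hMT,
      Matrix.mul_assoc, Matrix.nonsing_inv_mul _ hMu, Matrix.mul_one]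
  have hUMP : Uᵀ * M * Pr = Uᵀ * M := by
    rw [hUM, Matrix.mul_assoc, hproj]
  have hPD : M * Pr = Dᵀ * (Uᵀ * M) := by
    have := congrArg Matrix.transpose hD
    simp only [Matrix.transpose_mul, Matrix.transpose_nonsing_inv, Matrix.transpose_transpose,
      hMT] at this
    rw [← Matrix.mul_assoc, ← this]
    simp only [Matrix.mul_assoc, Matrix.nonsing_inv_mul _ hMu, Matrix.mul_one]
  have hL : M⁻¹ * Dᵀ * (Uᵀ * M * V) = V := by
    calc M⁻¹ * Dᵀ * (Uᵀ * M * V) = M⁻¹ * (Dᵀ * (Uᵀ * M)) * V := by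
          simp only [Matrix.mul_assoc]
      _ = (M⁻¹ * M) * (Pr * V) := by rw [← hPD]; simp only [Matrix.mul_assoc]
      _ = V := by rw [Matrix.nonsing_inv_mul _ hMu, hPV, Matrix.one_mul]
  have hunit : IsUnit (Uᵀ * M * V) := by
    rw [← Matrix.mulVec_injective_iff_isUnit]
    intro x y hxy
    have h2 : V *ᵥ x = V *ᵥ y := by
      have h5 := congrArg (fun z => (M⁻¹ * Dᵀ) *ᵥ z) hxy
      rwa [Matrix.mulVec_mulVec, Matrix.mulVec_mulVec, hL] at h5
    exact LinearMap.ker_eq_bot.mp hV h2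
  refine ⟨hunit, ?_⟩
  have hdet : IsUnit (Uᵀ * M * V).det := (Matrix.isUnit_iff_isUnit_det _).mp hunit
  have h3 : Uᵀ * M = (Uᵀ * M * V) * E := by
    rw [Matrix.mul_assoc (Uᵀ * M), ← hE, hUMP]
  have h4 : (Uᵀ * M * V)⁻¹ * (Uᵀ * M) = E := by
    calc (Uᵀ * M * V)⁻¹ * (Uᵀ * M) = (Uᵀ * M * V)⁻¹ * ((Uᵀ * M * V) * E) := by rw [← h3]
      _ = E := by rw [← Matrix.mul_assoc, Matrix.nonsing_inv_mul _ hdet, Matrix.one_mul]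
  rw [Matrix.mul_assoc V, h4, ← hE]
end

section
/- Let A be an n×n real invertible matrix, M an n×n real symmetric positive definite matrix, and let R and P be n×n_c real matrices such that R*AP is invertible; set Π = P(R*AP)⁻¹R*A. If there exist invertible n_c×n_c matrices B_P and B_R with MPB_P = A*RB_R, then Π is M-orthogonal, i.e. MΠ = Π*M (equivalently Π = M⁻¹Π*M). -/
open Matrix

/-- Let `A` be invertible, `M` SPD, `R`, `P` be `n × n_c` with
`Rᵀ A P` invertible, and `Π = P (Rᵀ A P)⁻¹ Rᵀ A`. If there exist invertible
`B_P`, `B_R` with `M P B_P = Aᵀ R B_R`, then `Π` is `M`-orthogonal: `M Π = Πᵀ M`. -/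
theorem compatible_transfer_M_orthogonal {n nc : ℕ}
    (A M : Matrix (Fin n) (Fin n) ℝ) (R P : Matrix (Fin n) (Fin nc) ℝ)
    (BP BR : Matrix (Fin nc) (Fin nc) ℝ)
    (hA : IsUnit A) (hM : M.PosDef) (hK : IsUnit (Rᵀ * A * P))
    (hBP : IsUnit BP) (hBR : IsUnit BR)
    (h : M * P * BP = Aᵀ * R * BR) :
    M * (P * (Rᵀ * A * P)⁻¹ * (Rᵀ * A)) = (P * (Rᵀ * A * P)⁻¹ * (Rᵀ * A))ᵀ * M := by
  have hMT : Mᵀ = M := by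
    have := hM.isHermitian
    rwa [Matrix.IsHermitian, Matrix.conjTranspose_eq_transpose_of_trivial] at this
  have hBPd : IsUnit BP.det := (Matrix.isUnit_iff_isUnit_det _).1 hBP
  have hC : M * P = (Rᵀ * A)ᵀ * (BR * BP⁻¹) := by
    have h2 : M * P * BP * BP⁻¹ = Aᵀ * R * BR * BP⁻¹ := by rw [h]
    rw [Matrix.mul_nonsing_inv_cancel_right _ _ hBPd] at h2
    rw [h2, Matrix.transpose_mul, Matrix.transpose_transpose, Matrix.mul_assoc (Aᵀ * R)]
  have hKd : IsUnit (Rᵀ * A * P).det := (Matrix.isUnit_iff_isUnit_det _).1 hK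
  generalize BR * BP⁻¹ = C at hC
  generalize Rᵀ * A = V at *
  have hCT : Pᵀ * M = Cᵀ * V := by
    have := congrArg Matrix.transpose hC
    simpa [Matrix.transpose_mul, hMT] using this
  have hsym : (V * P)ᵀ * C = Cᵀ * (V * P) := by
    rw [Matrix.transpose_mul, Matrix.mul_assoc, ← hC, ← Matrix.mul_assoc, hCT, Matrix.mul_assoc]
  generalize V * P = K at *
  have hKTd : IsUnit Kᵀ.det := by rwa [Matrix.det_transpose]
  have key : C * K⁻¹ = (K⁻¹)ᵀ * Cᵀ := by
    rw [Matrix.transpose_nonsing_inv]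
    calc C * K⁻¹ = Kᵀ⁻¹ * (Kᵀ * C) * K⁻¹ := by
          rw [Matrix.nonsing_inv_mul_cancel_left _ _ hKTd]
      _ = Kᵀ⁻¹ * Cᵀ := by
          rw [hsym, ← Matrix.mul_assoc, Matrix.mul_nonsing_inv_cancel_right _ _ hKd]
  calc M * (P * K⁻¹ * V) = (M * P) * K⁻¹ * V := by simp only [Matrix.mul_assoc]
    _ = Vᵀ * (C * K⁻¹) * V := by rw [hC]; simp only [Matrix.mul_assoc]
    _ = Vᵀ * (K⁻¹)ᵀ * (Pᵀ * M) := by rw [key, hCT]; simp only [Matrix.mul_assoc]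
    _ = (P * K⁻¹ * V)ᵀ * M := by
          rw [Matrix.transpose_mul, Matrix.transpose_mul]; simp only [Matrix.mul_assoc]
end

section
/- Let A be an n×n real invertible matrix partitioned into blocks A = [[A_ff, A_fc],[A_cf, A_cc]], and let R = [Z; I] and P = [W; I] with Z, W of size n_f×n_c, with R*AP invertible; set Π = P(R*AP)⁻¹R*A. If W A_fc* Z + W A_cc* − A_ff* Z − A_cf* = 0 (equivalently (Z*A_fc + A_cc)W* = Z*A_ff + A_cf), then Π is symmetric, i.e. Π is an orthogonal projection in the standard (M = I) inner product. -/
open Matrix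

/-- The coarse-grid correction projection `Π = P (Rᵀ A P)⁻¹ Rᵀ A`. -/
noncomputable def cgc {n nc : Type*} [Fintype n] [Fintype nc] [DecidableEq nc]
    (A : Matrix n n ℝ) (R P : Matrix n nc ℝ) : Matrix n n ℝ :=
  P * (Rᵀ * A * P)⁻¹ * (Rᵀ * A)

/-- With `A = [[A_ff, A_fc],[A_cf, A_cc]]` invertible, `R = [Z; I]`,
`P = [W; I]`, `Rᵀ A P` invertible, and `Π = P (Rᵀ A P)⁻¹ Rᵀ A`: if
`W A_fcᵀ Z + W A_ccᵀ − A_ffᵀ Z − A_cfᵀ = 0`, then `Π` is symmetric, i.e. an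
orthogonal projection in the standard (`M = I`) inner product. -/
theorem identity_orthogonal_condition {nf nc : ℕ}
    (Aff : Matrix (Fin nf) (Fin nf) ℝ) (Afc : Matrix (Fin nf) (Fin nc) ℝ)
    (Acf : Matrix (Fin nc) (Fin nf) ℝ) (Acc : Matrix (Fin nc) (Fin nc) ℝ)
    (Z W : Matrix (Fin nf) (Fin nc) ℝ)
    (A : Matrix (Fin nf ⊕ Fin nc) (Fin nf ⊕ Fin nc) ℝ)
    (R P : Matrix (Fin nf ⊕ Fin nc) (Fin nc) ℝ)
    (hAdef : A = fromBlocks Aff Afc Acf Acc)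
    (hRdef : R = fromRows Z (1 : Matrix (Fin nc) (Fin nc) ℝ))
    (hPdef : P = fromRows W (1 : Matrix (Fin nc) (Fin nc) ℝ))
    (hA : IsUnit A) (hK : IsUnit (Rᵀ * A * P))
    (h : W * Afcᵀ * Z + W * Accᵀ - Affᵀ * Z - Acfᵀ = 0) :
    cgc A R P = (cgc A R P)ᵀ := by
  have hB : Rᵀ * A = (Zᵀ * Afc + Acc) * Pᵀ := by
    have h2 := congrArg Matrix.transpose h
    simp only [transpose_sub, transpose_add, transpose_mul, transpose_transpose,
      transpose_zero] at h2
    have h3 : Zᵀ * Aff + Acf = (Zᵀ * Afc + Acc) * Wᵀ := by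
      rw [Matrix.add_mul, Matrix.mul_assoc]
      rw [sub_sub, sub_eq_zero] at h2
      exact h2.symm
    subst hAdef hRdef hPdef
    rw [transpose_fromRows, transpose_fromRows, fromCols_mul_fromBlocks, mul_fromCols, h3.symm]
    simp
  have hK2 : Rᵀ * A * P = (Zᵀ * Afc + Acc) * (Pᵀ * P) := by
    rw [hB, Matrix.mul_assoc]
  have hBu : IsUnit (Zᵀ * Afc + Acc).det := by
    rw [hK2, Matrix.isUnit_iff_isUnit_det, det_mul] at hK
    exact isUnit_of_mul_isUnit_left hK
  have key : cgc A R P = P * (Pᵀ * P)⁻¹ * Pᵀ := by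
    unfold cgc
    rw [hK2, hB, Matrix.mul_inv_rev]
    simp only [Matrix.mul_assoc]
    rw [Matrix.nonsing_inv_mul_cancel_left _ _ hBu]
  rw [key]
  simp only [transpose_mul, transpose_nonsing_inv, transpose_transpose, Matrix.mul_assoc]
end

section
/- Let A be an n×n real invertible matrix partitioned into blocks A = [[A_ff, A_fc],[A_cf, A_cc]] with A_ff invertible. Take the ideal restriction Z* = −A_cf A_ff⁻¹ (so R = [Z; I]) and W = 0 (so P = [0; I]). Then R*AP is invertible and the projection Π = P(R*AP)⁻¹R*A is symmetric, i.e. orthogonal in the standard inner product. -/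
open Matrix

/-- With `A` invertible, `A_ff` invertible, ideal restriction
`Zᵀ = −A_cf A_ff⁻¹` (so `R = [Z; I]`) and `W = 0` (so `P = [0; I]`): `Rᵀ A P` is
invertible and `Π = P (Rᵀ A P)⁻¹ Rᵀ A` is symmetric, i.e. orthogonal in the standard
inner product. -/
theorem ideal_restriction_identity_orthogonal {nf nc : ℕ}
    (Aff : Matrix (Fin nf) (Fin nf) ℝ) (Afc : Matrix (Fin nf) (Fin nc) ℝ)
    (Acf : Matrix (Fin nc) (Fin nf) ℝ) (Acc : Matrix (Fin nc) (Fin nc) ℝ)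
    (Z : Matrix (Fin nf) (Fin nc) ℝ)
    (A : Matrix (Fin nf ⊕ Fin nc) (Fin nf ⊕ Fin nc) ℝ)
    (R P : Matrix (Fin nf ⊕ Fin nc) (Fin nc) ℝ)
    (hAdef : A = fromBlocks Aff Afc Acf Acc)
    (hZ : Zᵀ = -(Acf * Aff⁻¹))
    (hRdef : R = fromRows Z (1 : Matrix (Fin nc) (Fin nc) ℝ))
    (hPdef : P = fromRows (0 : Matrix (Fin nf) (Fin nc) ℝ) (1 : Matrix (Fin nc) (Fin nc) ℝ))
    (hA : IsUnit A) (hAff : IsUnit Aff) :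
    IsUnit (Rᵀ * A * P) ∧ cgc A R P = (cgc A R P)ᵀ := by
  have hd : IsUnit Aff.det := (Matrix.isUnit_iff_isUnit_det _).1 hAff
  have hRA : Rᵀ * A = fromCols 0 (Acc - Acf * Aff⁻¹ * Afc) := by
    rw [hRdef, hAdef, transpose_fromRows, hZ, fromCols_mul_fromBlocks]
    congr 1
    · simp [Matrix.mul_assoc, Matrix.nonsing_inv_mul _ hd]
    · simp [sub_eq_add_neg, add_comm]
  have hRAP : Rᵀ * A * P = Acc - Acf * Aff⁻¹ * Afc := by
    rw [hRA, hPdef, fromCols_mul_fromRows]; simp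
  have hS : IsUnit (Acc - Acf * Aff⁻¹ * Afc) := by
    letI := hAff.invertible
    have h := (Matrix.isUnit_iff_isUnit_det _).1 hA
    rw [hAdef, det_fromBlocks₁₁, invOf_eq_nonsing_inv] at h
    exact (Matrix.isUnit_iff_isUnit_det _).2 (isUnit_of_mul_isUnit_right h)
  refine ⟨hRAP ▸ hS, ?_⟩
  have hPi : cgc A R P = fromBlocks 0 0 0 1 := by
    unfold cgc
    rw [hRAP, hRA, hPdef, fromRows_mul, fromRows_mul_fromCols]
    simp [Matrix.nonsing_inv_mul _ ((Matrix.isUnit_iff_isUnit_det _).1 hS)]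
  rw [hPi, fromBlocks_transpose]
  simp
end

section
/- Let A be an n×n real invertible matrix partitioned into blocks A = [[A_ff, A_fc],[A_cf, A_cc]], and let R = [Z; I] and P = [W; I] with Z, W of size n_f×n_c, with R*AP invertible; set Π = P(R*AP)⁻¹R*A. If Z A_cf W + Z A_cc − A_ff W − A_fc = 0, then Π is orthogonal in the A*A-inner product, i.e. (A*A)Π = Π*(A*A). -/
open Matrix

/-- With `A = [[A_ff, A_fc],[A_cf, A_cc]]` invertible, `R = [Z; I]`,
`P = [W; I]`, `Rᵀ A P` invertible, and `Π = P (Rᵀ A P)⁻¹ Rᵀ A`: if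
`Z A_cf W + Z A_cc − A_ff W − A_fc = 0`, then `Π` is orthogonal in the `AᵀA`-inner
product, i.e. `(AᵀA) Π = Πᵀ (AᵀA)`. -/
theorem AstarA_orthogonal_condition {nf nc : ℕ}
    (Aff : Matrix (Fin nf) (Fin nf) ℝ) (Afc : Matrix (Fin nf) (Fin nc) ℝ)
    (Acf : Matrix (Fin nc) (Fin nf) ℝ) (Acc : Matrix (Fin nc) (Fin nc) ℝ)
    (Z W : Matrix (Fin nf) (Fin nc) ℝ)
    (A : Matrix (Fin nf ⊕ Fin nc) (Fin nf ⊕ Fin nc) ℝ)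
    (R P : Matrix (Fin nf ⊕ Fin nc) (Fin nc) ℝ)
    (hAdef : A = fromBlocks Aff Afc Acf Acc)
    (hRdef : R = fromRows Z (1 : Matrix (Fin nc) (Fin nc) ℝ))
    (hPdef : P = fromRows W (1 : Matrix (Fin nc) (Fin nc) ℝ))
    (hA : IsUnit A) (hK : IsUnit (Rᵀ * A * P))
    (h : Z * Acf * W + Z * Acc - Aff * W - Afc = 0) :
    (Aᵀ * A) * cgc A R P = (cgc A R P)ᵀ * (Aᵀ * A) := by
  have hAP : A * P = R * (Acf * W + Acc) := by
    subst hAdef hRdef hPdef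
    rw [fromBlocks_mul_fromRows, fromRows_mul]
    have h1 : Aff * W + Afc = Z * (Acf * W + Acc) := by
      rw [Matrix.mul_add, ← Matrix.mul_assoc]
      rw [sub_sub, sub_eq_zero] at h
      exact h.symm
    simp [h1]
  generalize Acf * W + Acc = M at hAP
  have hK' : Rᵀ * A * P = (Rᵀ * R) * M := by
    rw [Matrix.mul_assoc, hAP, Matrix.mul_assoc]
  have hM : IsUnit M.det := by
    rw [hK', Matrix.isUnit_iff_isUnit_det, Matrix.det_mul] at hK
    exact isUnit_of_mul_isUnit_right hK
  have key : (Aᵀ * A) * cgc A R P = Aᵀ * R * (Rᵀ * R)⁻¹ * (Rᵀ * A) := by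
    unfold cgc
    rw [hK', Matrix.mul_inv_rev]
    calc (Aᵀ * A) * (P * (M⁻¹ * (Rᵀ * R)⁻¹) * (Rᵀ * A))
        = Aᵀ * (A * P) * M⁻¹ * (Rᵀ * R)⁻¹ * (Rᵀ * A) := by
          simp only [Matrix.mul_assoc]
      _ = Aᵀ * R * (M * M⁻¹) * (Rᵀ * R)⁻¹ * (Rᵀ * A) := by
          rw [hAP]; simp only [Matrix.mul_assoc]
      _ = _ := by rw [Matrix.mul_nonsing_inv _ hM, Matrix.mul_one]
  have ht : (cgc A R P)ᵀ * (Aᵀ * A) = ((Aᵀ * A) * cgc A R P)ᵀ := by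
    rw [Matrix.transpose_mul (Aᵀ * A), Matrix.transpose_mul Aᵀ, Matrix.transpose_transpose]
  rw [ht, key]
  simp only [Matrix.transpose_mul, Matrix.transpose_transpose, Matrix.transpose_nonsing_inv,
    Matrix.mul_assoc]
end

section
/- Let A be an n×n real invertible matrix partitioned into blocks A = [[A_ff, A_fc],[A_cf, A_cc]] with A_ff invertible. Take Z = 0 (so R = [0; I]) and the ideal interpolation W = −A_ff⁻¹A_fc (so P = [W; I]). Then R*AP is invertible and the projection Π = P(R*AP)⁻¹R*A satisfies (A*A)Π = Π*(A*A), i.e. Π is orthogonal in the A*A-inner product; moreover R*AP equals the Schur complement A_cc − A_cf A_ff⁻¹ A_fc. -/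
open Matrix

/-- With `A` invertible, `A_ff` invertible, `Z = 0` (so `R = [0; I]`)
and ideal interpolation `W = −A_ff⁻¹ A_fc` (so `P = [W; I]`): `Rᵀ A P` is
invertible, `Π = P (Rᵀ A P)⁻¹ Rᵀ A` satisfies `(AᵀA) Π = Πᵀ (AᵀA)`, and
`Rᵀ A P` equals the Schur complement `A_cc − A_cf A_ff⁻¹ A_fc`. -/
theorem ideal_interpolation_AstarA_orthogonal {nf nc : ℕ}
    (Aff : Matrix (Fin nf) (Fin nf) ℝ) (Afc : Matrix (Fin nf) (Fin nc) ℝ)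
    (Acf : Matrix (Fin nc) (Fin nf) ℝ) (Acc : Matrix (Fin nc) (Fin nc) ℝ)
    (A : Matrix (Fin nf ⊕ Fin nc) (Fin nf ⊕ Fin nc) ℝ)
    (R P : Matrix (Fin nf ⊕ Fin nc) (Fin nc) ℝ)
    (hAdef : A = fromBlocks Aff Afc Acf Acc)
    (hRdef : R = fromRows (0 : Matrix (Fin nf) (Fin nc) ℝ) (1 : Matrix (Fin nc) (Fin nc) ℝ))
    (hPdef : P = fromRows (-(Aff⁻¹ * Afc)) (1 : Matrix (Fin nc) (Fin nc) ℝ))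
    (hA : IsUnit A) (hAff : IsUnit Aff) :
    IsUnit (Rᵀ * A * P) ∧
    (Aᵀ * A) * cgc A R P = (cgc A R P)ᵀ * (Aᵀ * A) ∧
    Rᵀ * A * P = Acc - Acf * Aff⁻¹ * Afc := by
  have hAP : A * P = R * (Acc - Acf * Aff⁻¹ * Afc) := by
    have h1 : Aff * (Aff⁻¹ * Afc) = Afc := by
      rw [← Matrix.mul_assoc, Matrix.mul_nonsing_inv _ ((Matrix.isUnit_iff_isUnit_det _).1 hAff),
        Matrix.one_mul]
    rw [hAdef, hPdef, hRdef, fromBlocks_mul_fromRows, fromRows_mul]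
    simp only [Matrix.mul_neg, h1, Matrix.mul_one, Matrix.zero_mul, Matrix.one_mul,
      Matrix.mul_assoc]
    rw [neg_add_cancel, neg_add_eq_sub]
  have hRR : Rᵀ * R = 1 := by
    rw [hRdef, transpose_fromRows, fromCols_mul_fromRows]
    simp
  have hS : Rᵀ * A * P = Acc - Acf * Aff⁻¹ * Afc := by
    rw [Matrix.mul_assoc, hAP, ← Matrix.mul_assoc, hRR, Matrix.one_mul]
  have hU : IsUnit (Acc - Acf * Aff⁻¹ * Afc) := by
    rw [Matrix.isUnit_iff_isUnit_det] at hA ⊢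
    letI := hAff.invertible
    rw [hAdef, det_fromBlocks₁₁, Matrix.invOf_eq_nonsing_inv] at hA
    exact isUnit_of_mul_isUnit_right hA
  have hAC : A * cgc A R P = R * Rᵀ * A := by
    unfold cgc
    rw [hS, ← Matrix.mul_assoc, ← Matrix.mul_assoc, ← Matrix.mul_assoc, hAP, Matrix.mul_assoc R,
      Matrix.mul_nonsing_inv _ ((Matrix.isUnit_iff_isUnit_det _).1 hU), Matrix.mul_one]
  refine ⟨hS ▸ hU, ?_, hS⟩
  rw [← Matrix.mul_assoc, ← Matrix.transpose_mul, hAC, Matrix.mul_assoc Aᵀ, hAC]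
  simp only [Matrix.transpose_mul, Matrix.transpose_transpose, Matrix.mul_assoc]
end

section
/- Let A be an n×n real invertible matrix, M an n×n real symmetric positive definite matrix, and Q an n×n real matrix whose ff-block Q_ff is invertible and such that the ff-block of AM⁻¹Q* is invertible. Set P = P_ideal(Q), and let R = [Z; I] be any restriction such that R*AP is invertible and Π = P(R*AP)⁻¹R*A. Then Π is M-orthogonal (MΠ = Π*M) if and only if R = R_ideal(AM⁻¹Q*). -/
open Matrix

/-- Ideal interpolation `P_ideal(Q) = [−Q_ff⁻¹ Q_fc; I]`. -/
noncomputable def Pideal {nf nc : ℕ}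
    (Q : Matrix (Fin nf ⊕ Fin nc) (Fin nf ⊕ Fin nc) ℝ) :
    Matrix (Fin nf ⊕ Fin nc) (Fin nc) ℝ :=
  fromRows (-(Q.toBlocks₁₁⁻¹ * Q.toBlocks₁₂)) (1 : Matrix (Fin nc) (Fin nc) ℝ)

/-- Ideal restriction `R_ideal(Q) = [Z; I]` with `Zᵀ = −Q_cf Q_ff⁻¹`. -/
noncomputable def Rideal {nf nc : ℕ}
    (Q : Matrix (Fin nf ⊕ Fin nc) (Fin nf ⊕ Fin nc) ℝ) :
    Matrix (Fin nf ⊕ Fin nc) (Fin nc) ℝ :=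
  fromRows (-((Q.toBlocks₁₁ᵀ)⁻¹ * Q.toBlocks₂₁ᵀ)) (1 : Matrix (Fin nc) (Fin nc) ℝ)

lemma aux_toRows_mul {nf nc : ℕ} {k : Type*}
    (Q : Matrix (Fin nf ⊕ Fin nc) (Fin nf ⊕ Fin nc) ℝ)
    (X : Matrix (Fin nf ⊕ Fin nc) k ℝ) :
    (Q * X).toRows₁ = Q.toBlocks₁₁ * X.toRows₁ + Q.toBlocks₁₂ * X.toRows₂ := by
  ext i j
  simp [Matrix.mul_apply, toRows₁, toRows₂, toBlocks₁₁, toBlocks₁₂]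

lemma aux_ker {nf nc : ℕ} {Q : Matrix (Fin nf ⊕ Fin nc) (Fin nf ⊕ Fin nc) ℝ}
    (hQ : IsUnit Q.toBlocks₁₁)
    {X : Matrix (Fin nf ⊕ Fin nc) (Fin nc) ℝ} (h : (Q * X).toRows₁ = 0) :
    X = Pideal Q * X.toRows₂ := by
  rw [aux_toRows_mul] at h
  have hd := (Matrix.isUnit_iff_isUnit_det _).1 hQ
  have h1 : X.toRows₁ = -(Q.toBlocks₁₁⁻¹ * Q.toBlocks₁₂) * X.toRows₂ := by
    have h2 := congrArg (fun Y => Q.toBlocks₁₁⁻¹ * Y) h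
    simp only [Matrix.mul_add, Matrix.mul_zero, ← Matrix.mul_assoc,
      Matrix.nonsing_inv_mul _ hd, Matrix.one_mul] at h2
    rw [Matrix.neg_mul]
    exact eq_neg_of_add_eq_zero_left h2
  conv_lhs => rw [← fromRows_toRows X, h1]
  rw [Pideal, fromRows_mul, Matrix.one_mul]

lemma aux_QP {nf nc : ℕ} {Q : Matrix (Fin nf ⊕ Fin nc) (Fin nf ⊕ Fin nc) ℝ}
    (hQ : IsUnit Q.toBlocks₁₁) {k : Type*} (Y : Matrix (Fin nc) k ℝ) :
    (Q * (Pideal Q * Y)).toRows₁ = 0 := by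
  have hd := (Matrix.isUnit_iff_isUnit_det _).1 hQ
  rw [aux_toRows_mul, Pideal, fromRows_mul, toRows₁_fromRows, toRows₂_fromRows,
    Matrix.neg_mul, Matrix.mul_neg, Matrix.mul_assoc, Matrix.mul_nonsing_inv_cancel_left _ _ hd,
    Matrix.one_mul, neg_add_cancel]

lemma aux_R {nf nc : ℕ} {S : Matrix (Fin nf ⊕ Fin nc) (Fin nf ⊕ Fin nc) ℝ}
    (hS : IsUnit S.toBlocks₁₁) (Z : Matrix (Fin nf) (Fin nc) ℝ) :
    fromRows Z (1 : Matrix (Fin nc) (Fin nc) ℝ) = Rideal S ↔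
      (Sᵀ * fromRows Z (1 : Matrix (Fin nc) (Fin nc) ℝ)).toRows₁ = 0 := by
  have e : Rideal S = Pideal Sᵀ := rfl
  have hS' : IsUnit (Sᵀ).toBlocks₁₁ := by
    have : (Sᵀ).toBlocks₁₁ = S.toBlocks₁₁ᵀ := rfl
    rw [this, Matrix.isUnit_iff_isUnit_det, Matrix.det_transpose]
    exact (Matrix.isUnit_iff_isUnit_det _).1 hS
  rw [e]
  constructor
  · intro h
    rw [h]
    simpa using aux_QP hS' (1 : Matrix (Fin nc) (Fin nc) ℝ)
  · intro h
    simpa using aux_ker hS' h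

/-- Let `A` be invertible, `M` SPD, and `Q` with `Q_ff` invertible and
the ff-block of `A M⁻¹ Qᵀ` invertible. Set `P = P_ideal(Q)` and let `R = [Z; I]` be
any restriction with `Rᵀ A P` invertible, `Π = P (Rᵀ A P)⁻¹ Rᵀ A`. Then `Π` is
`M`-orthogonal (`M Π = Πᵀ M`) if and only if `R = R_ideal(A M⁻¹ Qᵀ)`. -/
theorem ideal_pair_R_from_P {nf nc : ℕ}
    (A M Q : Matrix (Fin nf ⊕ Fin nc) (Fin nf ⊕ Fin nc) ℝ)
    (Z : Matrix (Fin nf) (Fin nc) ℝ)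
    (R : Matrix (Fin nf ⊕ Fin nc) (Fin nc) ℝ)
    (hA : IsUnit A) (hM : M.PosDef)
    (hQff : IsUnit Q.toBlocks₁₁)
    (hQff' : IsUnit (A * M⁻¹ * Qᵀ).toBlocks₁₁)
    (hRdef : R = fromRows Z (1 : Matrix (Fin nc) (Fin nc) ℝ))
    (hK : IsUnit (Rᵀ * A * Pideal Q)) :
    M * cgc A R (Pideal Q) = (cgc A R (Pideal Q))ᵀ * M ↔
      R = Rideal (A * M⁻¹ * Qᵀ) := by
  have hMt : Mᵀ = M := by simpa using hM.isHermitian.eq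
  have hMd : IsUnit M.det := (Matrix.isUnit_iff_isUnit_det _).1 hM.isUnit
  have hMit : (M⁻¹)ᵀ = M⁻¹ := by rw [Matrix.transpose_nonsing_inv, hMt]
  have hSt : (A * M⁻¹ * Qᵀ)ᵀ * R = Q * (M⁻¹ * (Aᵀ * R)) := by
    simp only [Matrix.transpose_mul, Matrix.transpose_transpose, hMit, Matrix.mul_assoc]
  have key : R = Rideal (A * M⁻¹ * Qᵀ) ↔ (Q * (M⁻¹ * (Aᵀ * R))).toRows₁ = 0 := by
    rw [← hSt, hRdef]
    exact aux_R hQff' Z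
  rw [key]
  have hKd := (Matrix.isUnit_iff_isUnit_det _).1 hK
  constructor
  · intro h
    have h1 : Rᵀ * A * cgc A R (Pideal Q) = Rᵀ * A := by
      rw [cgc, ← Matrix.mul_assoc (Rᵀ * A), ← Matrix.mul_assoc (Rᵀ * A), Matrix.mul_nonsing_inv _ hKd,
        Matrix.one_mul]
    have h2 : (cgc A R (Pideal Q))ᵀ * (Aᵀ * R) = Aᵀ * R := by
      have := congrArg Matrix.transpose h1
      simpa only [Matrix.transpose_mul, Matrix.transpose_transpose] using this
    have h3 : M⁻¹ * (Aᵀ * R) = cgc A R (Pideal Q) * (M⁻¹ * (Aᵀ * R)) := by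
      have h4 : M * (cgc A R (Pideal Q) * (M⁻¹ * (Aᵀ * R))) = Aᵀ * R := by
        rw [← Matrix.mul_assoc, h, Matrix.mul_assoc, Matrix.mul_nonsing_inv_cancel_left _ _ hMd, h2]
      conv_lhs => rw [← h4]
      rw [Matrix.nonsing_inv_mul_cancel_left _ _ hMd]
    rw [h3, cgc, Matrix.mul_assoc, Matrix.mul_assoc]
    exact aux_QP hQff _
  · intro h
    have h1 := aux_ker hQff h
    generalize (M⁻¹ * (Aᵀ * R)).toRows₂ = C at h1
    generalize Pideal Q = P at *
    have h2 : Aᵀ * R = M * (P * C) := by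
      rw [← h1, Matrix.mul_nonsing_inv_cancel_left _ _ hMd]
    have h3 : Rᵀ * A = Cᵀ * (Pᵀ * M) := by
      have := congrArg Matrix.transpose h2
      simpa only [Matrix.transpose_mul, Matrix.transpose_transpose, hMt, Matrix.mul_assoc] using this
    have hC : IsUnit (Cᵀ).det := by
      rw [h3, Matrix.mul_assoc, Matrix.det_mul] at hKd
      exact isUnit_of_mul_isUnit_left hKd
    have h4 : cgc A R P = P * ((Pᵀ * M * P)⁻¹ * (Pᵀ * M)) := by
      rw [cgc, h3, Matrix.mul_assoc Cᵀ, Matrix.mul_inv_rev]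
      simp only [Matrix.mul_assoc]
      rw [Matrix.nonsing_inv_mul_cancel_left _ _ hC]
    rw [h4]
    simp only [Matrix.transpose_mul, Matrix.transpose_transpose, Matrix.transpose_nonsing_inv, hMt,
      Matrix.mul_assoc]
end

section
/- Let A be an n×n real invertible matrix, M an n×n real symmetric positive definite matrix, and Q an n×n real matrix whose ff-block Q_ff is invertible and such that the ff-block of Q*A⁻*M is invertible (A⁻* denotes the inverse transpose of A). Set R = R_ideal(Q), and let P = [W; I] be any interpolation such that R*AP is invertible and Π = P(R*AP)⁻¹R*A. Then Π is M-orthogonal (MΠ = Π*M) if and only if P = P_ideal(Q*A⁻*M). -/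
open Matrix

/-- Let `A` be invertible, `M` SPD, and `Q` with `Q_ff` invertible and
the ff-block of `Qᵀ A⁻ᵀ M` invertible. Set `R = R_ideal(Q)` and let `P = [W; I]` be
any interpolation with `Rᵀ A P` invertible, `Π = P (Rᵀ A P)⁻¹ Rᵀ A`. Then `Π` is
`M`-orthogonal (`M Π = Πᵀ M`) if and only if `P = P_ideal(Qᵀ A⁻ᵀ M)`. -/
theorem ideal_pair_P_from_R {nf nc : ℕ}
    (A M Q : Matrix (Fin nf ⊕ Fin nc) (Fin nf ⊕ Fin nc) ℝ)
    (W : Matrix (Fin nf) (Fin nc) ℝ)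
    (P : Matrix (Fin nf ⊕ Fin nc) (Fin nc) ℝ)
    (hA : IsUnit A) (hM : M.PosDef)
    (hQff : IsUnit Q.toBlocks₁₁)
    (hQff' : IsUnit (Qᵀ * (A⁻¹)ᵀ * M).toBlocks₁₁)
    (hPdef : P = fromRows W (1 : Matrix (Fin nc) (Fin nc) ℝ))
    (hK : IsUnit ((Rideal Q)ᵀ * A * P)) :
    M * cgc A (Rideal Q) P = (cgc A (Rideal Q) P)ᵀ * M ↔
      P = Pideal (Qᵀ * (A⁻¹)ᵀ * M) := by
  have hMt : Mᵀ = M := by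
    have h := hM.isHermitian
    rwa [Matrix.IsHermitian, Matrix.conjTranspose_eq_transpose_of_trivial] at h
  have hAd : IsUnit A.det := (Matrix.isUnit_iff_isUnit_det A).1 hA
  have hQd : IsUnit Q.toBlocks₁₁.det := (Matrix.isUnit_iff_isUnit_det _).1 hQff
  have hNd : IsUnit (Qᵀ * (A⁻¹)ᵀ * M).toBlocks₁₁.det := (Matrix.isUnit_iff_isUnit_det _).1 hQff'
  have hKd : IsUnit ((Rideal Q)ᵀ * A * P).det := (Matrix.isUnit_iff_isUnit_det _).1 hK
  have hRt : (Rideal Q)ᵀ = fromCols (-(Q.toBlocks₂₁ * Q.toBlocks₁₁⁻¹)) 1 := by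
    simp [Rideal, transpose_fromRows, transpose_nonsing_inv]
  obtain ⟨G, hG⟩ : ∃ G, G = A⁻¹ * fromRows Q.toBlocks₁₁ Q.toBlocks₂₁ := ⟨_, rfl⟩
  have hBG : (Rideal Q)ᵀ * A * G = 0 := by
    rw [hG, Matrix.mul_assoc, Matrix.mul_nonsing_inv_cancel_left _ _ hAd, hRt,
      fromCols_mul_fromRows, Matrix.neg_mul, Matrix.nonsing_inv_mul_cancel_right _ _ hQd]
    simp
  have hker : ∀ X : Matrix (Fin nf ⊕ Fin nc) (Fin nf ⊕ Fin nc) ℝ,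
      (Rideal Q)ᵀ * A * X = 0 → ∃ Y : Matrix (Fin nf) (Fin nf ⊕ Fin nc) ℝ, X = G * Y := by
    intro X hX
    have h2 : A * X = fromRows (A * X).toRows₁ (A * X).toRows₂ := (fromRows_toRows _).symm
    rw [Matrix.mul_assoc, hRt, h2, fromCols_mul_fromRows, Matrix.one_mul, Matrix.neg_mul,
      neg_add_eq_zero] at hX
    refine ⟨Q.toBlocks₁₁⁻¹ * (A * X).toRows₁, ?_⟩
    rw [hG, Matrix.mul_assoc, fromRows_mul, Matrix.mul_nonsing_inv_cancel_left _ _ hQd,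
      ← Matrix.mul_assoc Q.toBlocks₂₁, hX, fromRows_toRows,
      Matrix.nonsing_inv_mul_cancel_left _ _ hAd]
  have hP : P = Pideal (Qᵀ * (A⁻¹)ᵀ * M) ↔ Gᵀ * M * P = 0 := by
    have h1 : Gᵀ * M = fromCols (Qᵀ * (A⁻¹)ᵀ * M).toBlocks₁₁ (Qᵀ * (A⁻¹)ᵀ * M).toBlocks₁₂ := by
      have e : fromCols (Qᵀ * (A⁻¹)ᵀ * M).toBlocks₁₁ (Qᵀ * (A⁻¹)ᵀ * M).toBlocks₁₂
          = (Qᵀ).toRows₁ * (A⁻¹)ᵀ * M := by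
        ext i j
        cases j <;> rfl
      have e2 : (Qᵀ).toRows₁ = (fromRows Q.toBlocks₁₁ Q.toBlocks₂₁)ᵀ := by
        ext i j
        cases j <;> rfl
      rw [e, hG, transpose_mul, e2]
    rw [h1, hPdef, Pideal, fromCols_mul_fromRows, Matrix.mul_one]
    generalize (Qᵀ * (A⁻¹)ᵀ * M).toBlocks₁₁ = N1 at *
    generalize (Qᵀ * (A⁻¹)ᵀ * M).toBlocks₁₂ = N2 at *
    constructor
    · intro h
      have h := (fromRows_inj h).1
      rw [h, Matrix.mul_neg, Matrix.mul_nonsing_inv_cancel_left _ _ hNd]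
      simp
    · intro h
      rw [← eq_neg_iff_add_eq_zero] at h
      rw [← Matrix.mul_neg, ← h, Matrix.nonsing_inv_mul_cancel_left _ _ hNd]
  rw [hP]
  have hsym : Gᵀ * M * P = 0 ↔ Pᵀ * M * G = 0 := by
    rw [← Matrix.transpose_eq_zero]
    simp [transpose_mul, hMt, Matrix.mul_assoc]
  rw [hsym]
  unfold cgc
  generalize (Rideal Q)ᵀ * A = B at *
  constructor
  · intro h
    have h1 : (P * (B * P)⁻¹ * B)ᵀ * M * G = 0 := by
      rw [← h, Matrix.mul_assoc, Matrix.mul_assoc, hBG]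
      simp
    have h2 : Pᵀ * (P * (B * P)⁻¹ * B)ᵀ = Pᵀ := by
      rw [← transpose_mul, Matrix.mul_assoc, Matrix.mul_assoc,
        Matrix.nonsing_inv_mul _ hKd, Matrix.mul_one]
    rw [← h2, Matrix.mul_assoc, Matrix.mul_assoc, ← Matrix.mul_assoc _ M, h1, Matrix.mul_zero]
  · intro h
    obtain ⟨Y, hY⟩ := hker (1 - P * (B * P)⁻¹ * B) (by
      rw [Matrix.mul_sub, Matrix.mul_one, ← Matrix.mul_assoc, ← Matrix.mul_assoc,
        Matrix.mul_nonsing_inv _ hKd, Matrix.one_mul, sub_self])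
    obtain ⟨C, hC⟩ : ∃ C, C = P * (B * P)⁻¹ * B := ⟨_, rfl⟩
    have h3 : Cᵀ * M * (1 - C) = 0 := by
      rw [hC, hY]
      calc _ = Bᵀ * (B * P)⁻¹ᵀ * (Pᵀ * M * G) * Y := by
            simp only [transpose_mul, Matrix.mul_assoc]
        _ = 0 := by rw [h]; simp
    rw [← hC]
    rw [Matrix.mul_sub, Matrix.mul_one, sub_eq_zero] at h3
    have h4 := congrArg transpose h3
    simp only [transpose_mul, transpose_transpose, hMt] at h4
    rw [h4, h3, Matrix.mul_assoc]
end

section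
/- Let A be an n×n real invertible matrix partitioned into blocks with A_ff invertible. Let R = R_ideal(A) (i.e. Z* = −A_cf A_ff⁻¹) and P = [0; I] (i.e. W = 0), and let M = [[M_ff, 0],[0, M_cc]] be any block-diagonal matrix with M_ff and M_cc symmetric positive definite. Then R*AP is invertible and the projection Π = P(R*AP)⁻¹R*A is M-orthogonal: MΠ = Π*M. -/
open Matrix

/-- With `A` invertible and `A_ff` invertible, take the ideal
restriction `R = [Z; I]` with `Zᵀ = −A_cf A_ff⁻¹`, `P = [0; I]`, and any
block-diagonal `M = [[M_ff, 0],[0, M_cc]]` with `M_ff`, `M_cc` SPD. Then `Rᵀ A P`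
is invertible and `Π = P (Rᵀ A P)⁻¹ Rᵀ A` is `M`-orthogonal: `M Π = Πᵀ M`. -/
theorem ideal_restriction_blockdiag_orthogonal {nf nc : ℕ}
    (Aff : Matrix (Fin nf) (Fin nf) ℝ) (Afc : Matrix (Fin nf) (Fin nc) ℝ)
    (Acf : Matrix (Fin nc) (Fin nf) ℝ) (Acc : Matrix (Fin nc) (Fin nc) ℝ)
    (Mff : Matrix (Fin nf) (Fin nf) ℝ) (Mcc : Matrix (Fin nc) (Fin nc) ℝ)
    (Z : Matrix (Fin nf) (Fin nc) ℝ)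
    (A M : Matrix (Fin nf ⊕ Fin nc) (Fin nf ⊕ Fin nc) ℝ)
    (R P : Matrix (Fin nf ⊕ Fin nc) (Fin nc) ℝ)
    (hAdef : A = fromBlocks Aff Afc Acf Acc)
    (hMdef : M = fromBlocks Mff 0 0 Mcc)
    (hZ : Zᵀ = -(Acf * Aff⁻¹))
    (hRdef : R = fromRows Z (1 : Matrix (Fin nc) (Fin nc) ℝ))
    (hPdef : P = fromRows (0 : Matrix (Fin nf) (Fin nc) ℝ) (1 : Matrix (Fin nc) (Fin nc) ℝ))
    (hA : IsUnit A) (hAff : IsUnit Aff)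
    (hMff : Mff.PosDef) (hMcc : Mcc.PosDef) :
    IsUnit (Rᵀ * A * P) ∧ M * cgc A R P = (cgc A R P)ᵀ * M := by
  have hd : IsUnit Aff.det := (Matrix.isUnit_iff_isUnit_det _).1 hAff
  have hRA : Rᵀ * A = fromCols 0 (Acc - Acf * Aff⁻¹ * Afc) := by
    rw [hRdef, hAdef, transpose_fromRows, hZ, fromCols_mul_fromBlocks]
    congr 1
    · rw [transpose_one, Matrix.neg_mul, Matrix.mul_assoc, Matrix.nonsing_inv_mul _ hd]
      simp
    · rw [transpose_one, Matrix.neg_mul, Matrix.one_mul, neg_add_eq_sub]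
  have hRAP : Rᵀ * A * P = Acc - Acf * Aff⁻¹ * Afc := by
    rw [hRA, hPdef, fromCols_mul_fromRows]
    simp
  have hS : IsUnit (Acc - Acf * Aff⁻¹ * Afc) := by
    letI := Aff.invertibleOfIsUnitDet hd
    rw [hAdef, isUnit_fromBlocks_iff_of_invertible₁₁, invOf_eq_nonsing_inv] at hA
    exact hA
  refine ⟨hRAP ▸ hS, ?_⟩
  have hSd := (Matrix.isUnit_iff_isUnit_det _).1 hS
  have hc : cgc A R P = fromBlocks 0 0 0 1 := by
    unfold cgc
    rw [hRAP, hRA, hPdef, Matrix.mul_assoc, mul_fromCols, Matrix.nonsing_inv_mul _ hSd,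
      fromRows_mul_fromCols]
    simp
  rw [hc, hMdef, fromBlocks_transpose, fromBlocks_multiply, fromBlocks_multiply]
  simp
end
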